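/- arXiv:1107.5806 — 2 statements merged into one kernel-verified Lean document; each statement's English description precedes it below -/
import Mathlib

section
/- Let random variables V and W be jointly distributed with (X,Y,Z) such that the Markov chains V − X − (Y,W,Z) and (V,X,Z) − Y − W hold. Then there exists a random variable V′ taking at most |𝒳| + 1 values and satisfying the Markov chain V′ − X − (Y,W,Z), such that the joint distribution of (X,Y,W,Z) is unchanged when V is replaced by V′, and moreover H(X|V′,W,Z) = H(X|V,W,Z) and H(W|V′,Z) = H(W|V,Z); consequently I(V′;X|W,Z) = I(V;X|W,Z), I(Y;W|V′,Z) = I(Y;W|V,Z), and I(V′;X|Z) + I(Y;W|V′,Z) = I(V;X|Z) + I(Y;W|V,Z). -/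
open Finset

attribute [local instance] Classical.propDecidable

noncomputable section

/-- Probability of an event under a probability mass function on a finite sample space. -/
def pr {Ω : Type} [Fintype Ω] (μ : Ω → ℝ) (E : Set Ω) : ℝ :=
  ∑ ω, if ω ∈ E then μ ω else 0

/-- The distribution (law) of a random variable `X` under `μ`. -/
def law {Ω 𝒜 : Type} [Fintype Ω] (μ : Ω → ℝ) (X : Ω → 𝒜) : 𝒜 → ℝ :=
  fun a => pr μ {ω | X ω = a}

/-- Shannon entropy (base 2) of a discrete random variable. -/
def ent {Ω 𝒜 : Type} [Fintype Ω] [Fintype 𝒜] (μ : Ω → ℝ) (X : Ω → 𝒜) : ℝ :=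
  -∑ a, law μ X a * Real.logb 2 (law μ X a)

/-- Conditional entropy `H(X|Y) = H(X,Y) - H(Y)`. -/
def condEnt {Ω 𝒜 ℬ : Type} [Fintype Ω] [Fintype 𝒜] [Fintype ℬ]
    (μ : Ω → ℝ) (X : Ω → 𝒜) (Y : Ω → ℬ) : ℝ :=
  ent μ (fun ω => (X ω, Y ω)) - ent μ Y

/-- Mutual information `I(X;Y)`. -/
def mutInf {Ω 𝒜 ℬ : Type} [Fintype Ω] [Fintype 𝒜] [Fintype ℬ]
    (μ : Ω → ℝ) (X : Ω → 𝒜) (Y : Ω → ℬ) : ℝ :=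
  ent μ X + ent μ Y - ent μ (fun ω => (X ω, Y ω))

/-- Conditional mutual information `I(X;Y|Z)`. -/
def condMutInf {Ω 𝒜 ℬ 𝒞 : Type} [Fintype Ω] [Fintype 𝒜] [Fintype ℬ] [Fintype 𝒞]
    (μ : Ω → ℝ) (X : Ω → 𝒜) (Y : Ω → ℬ) (Z : Ω → 𝒞) : ℝ :=
  condEnt μ X Z + condEnt μ Y Z - condEnt μ (fun ω => (X ω, Y ω)) Z

/-- Markov chain `U − V − W`: `U` and `W` are conditionally independent given `V`. -/
def MarkovChain {Ω 𝒜 ℬ 𝒞 : Type} [Fintype Ω]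
    (μ : Ω → ℝ) (U : Ω → 𝒜) (V : Ω → ℬ) (W : Ω → 𝒞) : Prop :=
  ∀ a b c, pr μ {ω | U ω = a ∧ V ω = b ∧ W ω = c} * pr μ {ω | V ω = b}
    = pr μ {ω | U ω = a ∧ V ω = b} * pr μ {ω | V ω = b ∧ W ω = c}

/-- `⌈2^{nR}⌉`, the number of messages available at blocklength `n` and rate `R`. -/
def codeSize (n : ℕ) (R : ℝ) : ℕ := Nat.ceil ((2 : ℝ) ^ ((n : ℝ) * R))

/-- The i.i.d. product mass function on sequences of length `n`. -/
def iid {𝒜 : Type} (p : 𝒜 → ℝ) (n : ℕ) : (Fin n → 𝒜) → ℝ :=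
  fun s => ∏ i, p (s i)

/-- A rate pair `(RX, RY)` is achievable for computing `f` at a receiver knowing `Z`,
from separate encodings of `X` and `Y`, when `(X,Y,Z) ~ p` i.i.d. -/
def Achievable {𝒳 𝒴 𝒵 F : Type} [Fintype 𝒳] [Fintype 𝒴] [Fintype 𝒵] [Fintype F]
    (p : 𝒳 × 𝒴 × 𝒵 → ℝ) (f : 𝒳 → 𝒴 → 𝒵 → F) (RX RY : ℝ) : Prop :=
  ∀ ε : ℝ, 0 < ε → ∃ N : ℕ, ∀ n, N ≤ n →
    ∃ (φX : (Fin n → 𝒳) → Fin (codeSize n RX))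
      (φY : (Fin n → 𝒴) → Fin (codeSize n RY))
      (ψ : Fin (codeSize n RX) → Fin (codeSize n RY) → (Fin n → 𝒵) → (Fin n → F)),
      pr (iid p n)
        {s | ψ (φX fun i => (s i).1) (φY fun i => (s i).2.1) (fun i => (s i).2.2)
            ≠ fun i => f (s i).1 (s i).2.1 (s i).2.2} ≤ ε

/-- The rate region: the closure of the set of achievable rate pairs. -/
def RateRegion {𝒳 𝒴 𝒵 F : Type} [Fintype 𝒳] [Fintype 𝒴] [Fintype 𝒵] [Fintype F]
    (p : 𝒳 × 𝒴 × 𝒵 → ℝ) (f : 𝒳 → 𝒴 → 𝒵 → F) : Set (ℝ × ℝ) :=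
  closure {r | Achievable p f r.1 r.2}

/-- Conditional characteristic graph adjacency of `A` given `C`, w.r.t. joint
weights `q` and function `g`. -/
def charAdj {𝒜 𝒞 F : Type} (q : 𝒜 → 𝒞 → ℝ) (g : 𝒜 → 𝒞 → F) (a₁ a₂ : 𝒜) : Prop :=
  a₁ ≠ a₂ ∧ ∃ c, 0 < q a₁ c * q a₂ c ∧ g a₁ c ≠ g a₂ c

/-- Adjacency of the conditional characteristic graph `G_{X|Y,Z}`. -/
def adjXgYZ {𝒳 𝒴 𝒵 F : Type} (p : 𝒳 × 𝒴 × 𝒵 → ℝ) (f : 𝒳 → 𝒴 → 𝒵 → F) : 𝒳 → 𝒳 → Prop :=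
  charAdj (fun x (c : 𝒴 × 𝒵) => p (x, c.1, c.2)) (fun x c => f x c.1 c.2)

/-- Adjacency of the conditional characteristic graph `G_{Y|X,Z}`. -/
def adjYgXZ {𝒳 𝒴 𝒵 F : Type} (p : 𝒳 × 𝒴 × 𝒵 → ℝ) (f : 𝒳 → 𝒴 → 𝒵 → F) : 𝒴 → 𝒴 → Prop :=
  charAdj (fun y (c : 𝒳 × 𝒵) => p (c.1, y, c.2)) (fun y c => f c.1 y c.2)

/-- Adjacency of the conditional characteristic graph `G_{X,Y|Z}`. -/
def adjXYgZ {𝒳 𝒴 𝒵 F : Type} (p : 𝒳 × 𝒴 × 𝒵 → ℝ) (f : 𝒳 → 𝒴 → 𝒵 → F) :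
    (𝒳 × 𝒴) → (𝒳 × 𝒴) → Prop :=
  charAdj (fun a (z : 𝒵) => p (a.1, a.2, z)) (fun a z => f a.1 a.2 z)

/-- `s` is an independent set of the graph with adjacency `adj`. -/
def IndepFinset {𝒜 : Type} (adj : 𝒜 → 𝒜 → Prop) (s : Finset 𝒜) : Prop :=
  ∀ a₁ ∈ s, ∀ a₂ ∈ s, ¬ adj a₁ a₂

/-- `s` is a maximal independent set of the graph with adjacency `adj`. -/
def MaxIndepFinset {𝒜 : Type} (adj : 𝒜 → 𝒜 → Prop) (s : Finset 𝒜) : Prop :=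
  IndepFinset adj s ∧ ∀ t, IndepFinset adj t → s ⊆ t → t = s

/-- Adjacency of the generalized conditional characteristic graph `G_{Y|V,Z}` (a graph on
the values of `Y`): `y₁ ∼ y₂` iff they are distinct and there are `v, z` with
`p(v,y₁,z)·p(v,y₂,z) > 0` on which the function `f̃_X` (computed through the hidden
variable `X`) takes different values. -/
def genAdj {Ω 𝒱 𝒳 𝒴 𝒵 F : Type} [Fintype Ω] (μ : Ω → ℝ)
    (V : Ω → 𝒱) (X : Ω → 𝒳) (Y : Ω → 𝒴) (Z : Ω → 𝒵) (f : 𝒳 → 𝒴 → 𝒵 → F)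
    (y₁ y₂ : 𝒴) : Prop :=
  y₁ ≠ y₂ ∧ ∃ v z x₁ x₂,
    0 < pr μ {ω | V ω = v ∧ X ω = x₁ ∧ Y ω = y₁ ∧ Z ω = z} ∧
    0 < pr μ {ω | V ω = v ∧ X ω = x₂ ∧ Y ω = y₂ ∧ Z ω = z} ∧
    f x₁ y₁ z ≠ f x₂ y₂ z

/-- Conditional graph entropy `H_G(A|C)`: the infimum of `I(V;A|C)` over all joint
distributions `μ` of `(V,A,C)` whose `(A,C)`-marginal is `q`, satisfying the Markov
chain `V − A − C` with `A ∈ V ∈ Γ*(G)`. -/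
def condGraphEnt {𝒜 𝒞 : Type} [Fintype 𝒜] [Fintype 𝒞]
    (adj : 𝒜 → 𝒜 → Prop) (q : 𝒜 × 𝒞 → ℝ) : ℝ :=
  sInf { r : ℝ | ∃ μ : Finset 𝒜 × 𝒜 × 𝒞 → ℝ,
    (∀ a, 0 ≤ μ a) ∧ (∑ a, μ a = 1) ∧
    (∀ x c, (∑ v, μ (v, x, c)) = q (x, c)) ∧
    MarkovChain μ (fun a => a.1) (fun a => a.2.1) (fun a => a.2.2) ∧
    (∀ v x c, 0 < μ (v, x, c) → x ∈ v) ∧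
    (∀ v x c, 0 < μ (v, x, c) → MaxIndepFinset adj v) ∧
    r = condMutInf μ (fun a => a.1) (fun a => a.2.1) (fun a => a.2.2) }

/-- The support set `{x : p(v,x) > 0}` attached to an index `v` of `V`. -/
def suppSet {Ω 𝒱 𝒜 : Type} [Fintype Ω] [Fintype 𝒜] (μ : Ω → ℝ)
    (V : Ω → 𝒱) (X : Ω → 𝒜) (v : 𝒱) : Finset 𝒜 :=
  Finset.univ.filter (fun x => 0 < pr μ {ω | V ω = v ∧ X ω = x})

/-- The support-set random variable `S_X(V) = (V, {x : p(V,x) > 0})`. -/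
def suppVar {Ω 𝒱 𝒜 : Type} [Fintype Ω] [Fintype 𝒜] (μ : Ω → ℝ)
    (V : Ω → 𝒱) (X : Ω → 𝒜) : Ω → 𝒱 × Finset 𝒜 :=
  fun ω => (V ω, suppSet μ V X (V ω))

section Caratheodory

open Module

universe u

variable {E : Type u} [NormedAddCommGroup E] [NormedSpace ℝ E] [FiniteDimensional ℝ E]

/-- If `b` is a basis lying in the affine hyperplane `ℓ = 1` and `s` is a preconnected subset of
this hyperplane containing `b`, then some point of `s` has two coordinates which are both maximal
relative to given positive weights. -/
theorem IsPreconnected.exists_two_maximal_coords {ι : Type u} [Fintype ι] {s : Set E}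
    (hs : IsPreconnected s) (b : Basis ι ℝ E) (hb : ∀ i, b i ∈ s) {w : ι → ℝ} (hw : ∀ i, 0 < w i)
    {i₀ i₁ : ι} (hne : i₁ ≠ i₀) :
    ∃ y ∈ s, ∃ i, i ≠ i₀ ∧ (∀ j, b.repr y j / w j ≤ b.repr y i₀ / w i₀) ∧
      (∀ j, b.repr y j / w j ≤ b.repr y i / w i) := by
  have hcont : ∀ i, Continuous fun y => b.repr y i / w i := fun i =>
    ((b.coord i).continuous_of_finiteDimensional).div_const _
  have hvertex : ∀ i j, b.repr (b i) j / w j ≤ b.repr (b i) i / w i := by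
    intro i j
    rcases eq_or_ne j i with rfl | hji
    · exact le_rfl
    · simpa [Finsupp.single_apply, hji.symm] using (hw i).le
  have hclosed : ∀ i, IsClosed {y | ∀ j, b.repr y j / w j ≤ b.repr y i / w i} := by
    intro i
    simp only [Set.ofPred_forall]
    exact isClosed_iInter fun j => isClosed_le (hcont j) (hcont i)
  obtain ⟨y, hys, hy₀, hy⟩ := isPreconnected_closed_iff.1 hs
    {y | ∀ j, b.repr y j / w j ≤ b.repr y i₀ / w i₀}
    (⋃ i ∈ {i | i ≠ i₀}, {y | ∀ j, b.repr y j / w j ≤ b.repr y i / w i})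
    (hclosed i₀) (Set.toFinite _ |>.isClosed_biUnion fun i _ => hclosed i)
    (by
      intro y _
      have : Nonempty ι := ⟨i₀⟩
      obtain ⟨i, hi⟩ := Finite.exists_max fun i => b.repr y i / w i
      rcases eq_or_ne i i₀ with rfl | h
      · exact Or.inl hi
      · exact Or.inr (Set.mem_biUnion (show i ∈ {i | i ≠ i₀} from h) hi))
    ⟨b i₀, hb i₀, hvertex i₀⟩
    ⟨b i₁, hb i₁, Set.mem_biUnion (show i₁ ∈ {i | i ≠ i₀} from hne) (hvertex i₁)⟩
  obtain ⟨i, hi, hyi⟩ := Set.mem_iUnion₂.1 hy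
  exact ⟨y, hys, i, hi, hy₀, hyi⟩

/-- **Fenchel–Bunt theorem**, for a preconnected set in the affine hyperplane `ℓ = 1`: a point of
the convex hull is a convex combination of fewer than `finrank ℝ E` points of the set. -/
theorem IsPreconnected.exists_card_lt_of_mem_convexHull {s : Set E} (hs : IsPreconnected s)
    (ℓ : E →ₗ[ℝ] ℝ) (hℓ : ∀ x ∈ s, ℓ x = 1) (hE : 2 ≤ finrank ℝ E) {x : E}
    (hx : x ∈ convexHull ℝ s) :
    ∃ (ι : Type u) (_ : Fintype ι), Fintype.card ι < finrank ℝ E ∧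
      ∃ (z : ι → E) (w : ι → ℝ), (∀ i, z i ∈ s) ∧ (∀ i, 0 ≤ w i) ∧ ∑ i, w i = 1 ∧
        ∑ i, w i • z i = x := by
  obtain ⟨ι, _, z, w, hz, hind, hw, hw1, hwx⟩ := eq_pos_convex_span_of_mem_convexHull hx
  have hzs : ∀ i, z i ∈ s := fun i => hz ⟨i, rfl⟩
  have hlin : LinearIndependent ℝ z := by
    rw [linearIndependent_iff']
    intro t g hg
    refine affineIndependent_iff.1 hind t g ?_ hg
    simpa [map_sum, hℓ _ (hzs _)] using congrArg ℓ hg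
  rcases hlin.fintype_card_le_finrank.lt_or_eq with hlt | hcard
  · exact ⟨ι, _, hlt, z, w, hzs, fun i => (hw i).le, hw1, hwx⟩
  let b := basisOfLinearIndependentOfCardEqFinrank' z hlin hcard
  have hb : ⇑b = z := coe_basisOfLinearIndependentOfCardEqFinrank' z hlin hcard
  obtain ⟨i₁, i₀, hne⟩ := Fintype.exists_pair_of_one_lt_card (α := ι) (by omega)
  obtain ⟨y, hys, i, hi, hmax₀, hmax⟩ :=
    hs.exists_two_maximal_coords b (fun i => hb ▸ hzs i) hw hne
  have hyz : ∑ j, b.repr y j • z j = y := by simpa [hb] using b.sum_repr y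
  have hsum : ∑ j, b.repr y j = 1 := by
    simpa [map_sum, hℓ _ (hzs _), hℓ _ hys] using congrArg ℓ hyz
  set M := b.repr y i₀ / w i₀ with hM
  have hMi : b.repr y i / w i = M := le_antisymm (hmax₀ i) (hmax i₀)
  have hle : ∀ j, b.repr y j ≤ M * w j := fun j => (div_le_iff₀ (hw j)).1 (hmax₀ j)
  have hMpos : 0 < M := by
    have : (1 : ℝ) ≤ M := by
      calc (1 : ℝ) = ∑ j, b.repr y j := hsum.symm
        _ ≤ ∑ j, M * w j := Finset.sum_le_sum fun j _ => hle j
        _ = M := by rw [← Finset.mul_sum, hw1, mul_one]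
    linarith
  have hzero : ∀ k, b.repr y k / w k = M → w k - M⁻¹ * b.repr y k = 0 := by
    intro k hk
    have hwk := (hw k).ne'
    have : b.repr y k = M * w k := by rw [← hk]; field_simp
    rw [this]
    field_simp
    ring
  have hnonneg : ∀ k, 0 ≤ w k - M⁻¹ * b.repr y k := by
    intro k
    have := mul_le_mul_of_nonneg_left (hle k) (inv_pos.2 hMpos).le
    rw [← mul_assoc, inv_mul_cancel₀ hMpos.ne', one_mul] at this
    linarith
  have hwsum : ∑ k, ((w k - M⁻¹ * b.repr y k) + if k = i₀ then M⁻¹ else 0) = 1 := by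
    simp [Finset.sum_add_distrib, Finset.sum_sub_distrib, ← Finset.mul_sum, hw1, hsum]
  have hwz : ∑ k, ((w k - M⁻¹ * b.repr y k) • z k + if k = i₀ then M⁻¹ • y else 0) = x := by
    simp [Finset.sum_add_distrib, Finset.sum_sub_distrib, sub_smul, mul_smul, ← Finset.smul_sum,
      hwx, hyz]
  have hrestrict : ∀ {G : Type u} [AddCommMonoid G] (g : ι → G), g i = 0 →
      ∑ k : {k // k ≠ i}, g k = ∑ k, g k := by
    intro G _ g hg
    rw [← Finset.sum_subtype (Finset.univ.erase i) (by simp) g, Finset.sum_erase _ hg]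
  refine ⟨{k // k ≠ i}, inferInstance, ?_, fun k => if (k : ι) = i₀ then y else z k,
    fun k => (w k - M⁻¹ * b.repr y k) + if (k : ι) = i₀ then M⁻¹ else 0, ?_, ?_, ?_, ?_⟩
  · rw [← hcard]
    exact Fintype.card_subtype_lt (x := i) (by simp)
  · intro k
    dsimp only
    split_ifs
    exacts [hys, hzs k]
  · intro k
    have := hnonneg k
    dsimp only
    split_ifs <;> positivity
  · rw [← hwsum]
    simp only [← Finset.sum_subtype (Finset.univ.erase i) (p := fun k => k ≠ i) (by simp)
      fun k => (w k - M⁻¹ * b.repr y k) + if k = i₀ then M⁻¹ else 0]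
    exact Finset.sum_erase _ (by simp [hzero i hMi, hi])
  · rw [← hwz, ← hrestrict _ (by simp [hzero i hMi, hi])]
    refine Finset.sum_congr rfl fun k _ => ?_
    rcases eq_or_ne (k : ι) i₀ with h | h
    · simp only [h, if_true, hzero i₀ rfl]
      simp
    · simp only [h, if_false, add_zero]

/-- Fenchel–Bunt with an index set of prescribed size. -/
theorem IsPreconnected.exists_fin_of_mem_convexHull {s : Set E} (hs : IsPreconnected s)
    (ℓ : E →ₗ[ℝ] ℝ) (hℓ : ∀ x ∈ s, ℓ x = 1) {n : ℕ} (hn : 1 ≤ n) (hE : finrank ℝ E = n + 1)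
    {x : E} (hx : x ∈ convexHull ℝ s) :
    ∃ (z : Fin n → E) (w : Fin n → ℝ), (∀ i, z i ∈ s) ∧ (∀ i, 0 ≤ w i) ∧ ∑ i, w i = 1 ∧
      ∑ i, w i • z i = x := by
  obtain ⟨ι, _, hcard, z, w, hz, hw, hw1, hwx⟩ :=
    hs.exists_card_lt_of_mem_convexHull ℓ hℓ (by omega) hx
  obtain ⟨y, hy⟩ := convexHull_nonempty_iff.1 ⟨x, hx⟩
  obtain ⟨e⟩ := Function.Embedding.nonempty_of_card_le (α := ι) (β := Fin n)
    (by rw [Fintype.card_fin]; omega)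
  have hout : ∀ k, k ∉ Set.range e → Function.extend e w 0 k = 0 := fun k hk =>
    Function.extend_apply' _ _ _ hk
  refine ⟨Function.extend e z fun _ => y, Function.extend e w 0, ?_, ?_, ?_, ?_⟩
  · intro k
    by_cases hk : ∃ i, e i = k
    · obtain ⟨i, rfl⟩ := hk
      rw [e.injective.extend_apply]
      exact hz i
    · rw [Function.extend_apply' _ _ _ hk]
      exact hy
  · intro k
    by_cases hk : ∃ i, e i = k
    · obtain ⟨i, rfl⟩ := hk
      rw [e.injective.extend_apply]
      exact hw i
    · rw [Function.extend_apply' _ _ _ hk]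
      exact le_rfl
  · rw [← hw1]
    exact (Fintype.sum_of_injective e e.injective _ _ hout
      fun i => (e.injective.extend_apply _ _ _).symm).symm
  · rw [← hwx]
    exact (Fintype.sum_of_injective e e.injective _ _ (fun k hk => by simp [hout k hk])
      fun i => by simp [e.injective.extend_apply]).symm

end Caratheodory

section Laws

variable {Ω 𝒜 ℬ 𝒞 : Type} [Fintype Ω]

theorem law_apply (μ : Ω → ℝ) (T : Ω → 𝒜) (a : 𝒜) :
    law μ T a = ∑ ω, if T ω = a then μ ω else 0 := rfl

theorem law_nonneg {μ : Ω → ℝ} (hμ : ∀ ω, 0 ≤ μ ω) (T : Ω → 𝒜) (a : 𝒜) : 0 ≤ law μ T a :=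
  Finset.sum_nonneg fun ω _ => by split_ifs; exacts [hμ ω, le_rfl]

theorem sum_law [Fintype 𝒜] (μ : Ω → ℝ) (T : Ω → 𝒜) : ∑ a, law μ T a = ∑ ω, μ ω := by
  simp only [law_apply]
  rw [Finset.sum_comm]
  simp

theorem law_law [Fintype 𝒜] (μ : Ω → ℝ) (T : Ω → 𝒜) (g : 𝒜 → ℬ) :
    law (law μ T) g = law μ fun ω => g (T ω) := by
  funext b
  simp only [law_apply]
  have : ∀ a, (if g a = b then ∑ ω, if T ω = a then μ ω else 0 else 0)
      = ∑ ω, if T ω = a then (if g (T ω) = b then μ ω else 0) else 0 := by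
    intro a
    split_ifs with h
    · refine Finset.sum_congr rfl fun ω _ => ?_
      split_ifs <;> simp_all
    · refine (Finset.sum_eq_zero fun ω _ => ?_).symm
      split_ifs with h1 <;> simp_all
  simp only [this]
  rw [Finset.sum_comm]
  simp

theorem law_comp_injective (μ : Ω → ℝ) (T : Ω → 𝒜) {g : 𝒜 → ℬ} (hg : Function.Injective g)
    (a : 𝒜) : law μ (fun ω => g (T ω)) (g a) = law μ T a := by
  simp [law_apply, hg.eq_iff]

theorem law_injective [Fintype 𝒜] (q : 𝒜 → ℝ) {g : 𝒜 → ℬ} (hg : Function.Injective g) (a : 𝒜) :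
    law q g (g a) = q a := by
  simp [law_apply, hg.eq_iff]

theorem law_snd [Fintype 𝒜] [Fintype ℬ] (q : 𝒜 × ℬ → ℝ) (b : ℬ) :
    law q (fun t => t.2) b = ∑ a, q (a, b) := by
  simp [law_apply, Fintype.sum_prod_type]

theorem sum_law_pair_right [Fintype ℬ] (μ : Ω → ℝ) (S : Ω → 𝒜) (T : Ω → ℬ) (a : 𝒜) :
    ∑ b, law μ (fun ω => (S ω, T ω)) (a, b) = law μ S a := by
  simp only [law_apply, Prod.mk.injEq, ite_and]
  rw [Finset.sum_comm]
  refine Finset.sum_congr rfl fun ω _ => ?_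
  split_ifs <;> simp

theorem sum_law_pair_left [Fintype 𝒜] (μ : Ω → ℝ) (S : Ω → 𝒜) (T : Ω → ℬ) (b : ℬ) :
    ∑ a, law μ (fun ω => (S ω, T ω)) (a, b) = law μ T b := by
  rw [← sum_law_pair_right μ T S b]
  refine Finset.sum_congr rfl fun a _ => ?_
  simp [law_apply, and_comm]

theorem law_eq_zero_of_law_comp_eq_zero [Fintype 𝒜] {μ : Ω → ℝ} (hμ : ∀ ω, 0 ≤ μ ω) (T : Ω → 𝒜) (g : 𝒜 → ℬ)
    {a : 𝒜} (h : law μ (fun ω => g (T ω)) (g a) = 0) : law μ T a = 0 := by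
  rw [← law_law, law_apply,
    Finset.sum_eq_zero_iff_of_nonneg fun a' _ => by
      split_ifs; exacts [law_nonneg hμ T a', le_rfl]] at h
  simpa using h a (Finset.mem_univ a)

theorem ent_law [Fintype 𝒜] [Fintype ℬ] (μ : Ω → ℝ) (T : Ω → 𝒜) (g : 𝒜 → ℬ) :
    ent (law μ T) g = ent μ fun ω => g (T ω) := by
  simp only [ent, law_law]

theorem condEnt_law [Fintype 𝒜] [Fintype ℬ] [Fintype 𝒞] (μ : Ω → ℝ) (T : Ω → 𝒜) (f : 𝒜 → ℬ)
    (g : 𝒜 → 𝒞) :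
    condEnt (law μ T) f g = condEnt μ (fun ω => f (T ω)) fun ω => g (T ω) := by
  simp only [condEnt, ent_law μ T g, ent_law μ T fun a => (f a, g a)]

theorem ent_comp_equiv [Fintype 𝒜] [Fintype ℬ] (μ : Ω → ℝ) (T : Ω → 𝒜) (e : 𝒜 ≃ ℬ) :
    ent μ (fun ω => e (T ω)) = ent μ T := by
  simp only [ent, ← e.sum_comp, law_comp_injective μ T e.injective]

/-- Random variables determining each other have the same entropy. -/
theorem ent_eq_of_comp [Fintype 𝒜] [Fintype ℬ] {μ : Ω → ℝ} {S : Ω → 𝒜} {T : Ω → ℬ} (g : 𝒜 → ℬ) (h : ℬ → 𝒜)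
    (hgh : Function.LeftInverse h g) (hhg : Function.RightInverse h g) (hT : ∀ ω, T ω = g (S ω)) :
    ent μ T = ent μ S := by
  obtain rfl : T = fun ω => g (S ω) := funext hT
  exact ent_comp_equiv μ S ⟨g, h, hgh, hhg⟩

theorem continuous_ent [Fintype 𝒜] (g : Ω → 𝒜) : Continuous fun μ : Ω → ℝ => ent μ g := by
  have hlaw : ∀ a, Continuous fun μ : Ω → ℝ => law μ g a := by
    intro a
    simp only [law_apply]
    refine continuous_finsetSum _ fun ω _ => ?_
    split_ifs <;> fun_prop
  simp only [ent, Real.logb, ← mul_div_assoc]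
  refine (continuous_finsetSum _ fun a _ => ?_).neg
  exact (Real.continuous_mul_log.comp (hlaw a)).div_const _

theorem mul_mul_logb_mul (x y : ℝ) :
    x * y * Real.logb 2 (x * y) = x * (y * Real.logb 2 y) + x * Real.logb 2 x * y := by
  rcases eq_or_ne x 0 with rfl | hx
  · simp
  rcases eq_or_ne y 0 with rfl | hy
  · simp
  rw [Real.logb_mul hx hy]
  ring

/-- Entropy of a mixture, jointly with the mixing variable. -/
theorem ent_mixture [Fintype 𝒜] [Fintype ℬ] (c : 𝒜 → ℝ) (j : 𝒜 → Ω → ℝ) (g : Ω → ℬ) :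
    ent (fun t : 𝒜 × Ω => c t.1 * j t.1 t.2) (fun t => (t.1, g t.2))
      = ∑ a, c a * ent (j a) g - ∑ a, c a * Real.logb 2 (c a) * ∑ ω, j a ω := by
  have hlaw : ∀ a b, law (fun t : 𝒜 × Ω => c t.1 * j t.1 t.2) (fun t => (t.1, g t.2)) (a, b)
      = c a * law (j a) g b := by
    intro a b
    simp only [law_apply, Fintype.sum_prod_type, Prod.mk.injEq, ite_and, Finset.mul_sum, mul_ite,
      mul_zero]
    rw [Finset.sum_eq_single a (fun a' _ h => by simp [h]) (by simp)]
    simp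
  simp only [ent, Fintype.sum_prod_type, hlaw, mul_mul_logb_mul, Finset.sum_add_distrib,
    ← Finset.mul_sum, sum_law, mul_neg, Finset.sum_neg_distrib]
  ring

/-- Conditional entropy given the mixing variable is affine in the mixture. -/
theorem condEnt_mixture [Fintype 𝒜] [Fintype ℬ] [Fintype 𝒞] (c : 𝒜 → ℝ) (j : 𝒜 → Ω → ℝ) (f : Ω → ℬ) (g : Ω → 𝒞) :
    condEnt (fun t : 𝒜 × Ω => c t.1 * j t.1 t.2) (fun t => f t.2) (fun t => (t.1, g t.2))
      = ∑ a, c a * condEnt (j a) f g := by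
  have hperm : ent (fun t : 𝒜 × Ω => c t.1 * j t.1 t.2) (fun t => (f t.2, (t.1, g t.2)))
      = ent (fun t : 𝒜 × Ω => c t.1 * j t.1 t.2) (fun t => (t.1, (f t.2, g t.2))) :=
    ent_eq_of_comp (fun p => (p.2.1, (p.1, p.2.2))) (fun p => (p.2.1, (p.1, p.2.2)))
      (fun _ => rfl) (fun _ => rfl) fun _ => rfl
  simp only [condEnt, hperm, ent_mixture, ent_mixture c j fun ω => (f ω, g ω), mul_sub,
    Finset.sum_sub_distrib]
  ring

end Laws

section Markov

variable {Ω 𝒜 ℬ 𝒞 𝒟 : Type} [Fintype Ω]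
  {μ : Ω → ℝ} {A : Ω → 𝒜} {B : Ω → ℬ} {C : Ω → 𝒞}

theorem markovChain_iff_law :
    MarkovChain μ A B C ↔ ∀ a b c,
      law μ (fun ω => (A ω, B ω, C ω)) (a, b, c) * law μ B b
        = law μ (fun ω => (A ω, B ω)) (a, b) * law μ (fun ω => (B ω, C ω)) (b, c) := by
  simp only [MarkovChain, law, Prod.mk.injEq]

theorem MarkovChain.symm (h : MarkovChain μ A B C) : MarkovChain μ C B A := by
  intro c b a
  have h1 : {ω | C ω = c ∧ B ω = b ∧ A ω = a} = {ω | A ω = a ∧ B ω = b ∧ C ω = c} := by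
    ext; simp; tauto
  have h2 : {ω | C ω = c ∧ B ω = b} = {ω | B ω = b ∧ C ω = c} := by ext; simp; tauto
  have h3 : {ω | B ω = b ∧ A ω = a} = {ω | A ω = a ∧ B ω = b} := by ext; simp; tauto
  rw [h1, h2, h3, h a b c, mul_comm]

theorem MarkovChain.comp_left [Fintype 𝒜] [Fintype ℬ] [Fintype 𝒞] (h : MarkovChain μ A B C) (g : 𝒜 → 𝒟) :
    MarkovChain μ (fun ω => g (A ω)) B C := by
  rw [markovChain_iff_law] at h ⊢
  intro d b c
  have h3 : law μ (fun ω => (g (A ω), B ω, C ω)) (d, b, c)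
      = ∑ a, if g a = d then law μ (fun ω => (A ω, B ω, C ω)) (a, b, c) else 0 := by
    rw [← law_law μ (fun ω => (A ω, B ω, C ω)) fun p => (g p.1, p.2), law_apply,
      Fintype.sum_prod_type]
    refine Finset.sum_congr rfl fun a _ => ?_
    simp only [Prod.mk.injEq, ite_and]
    split_ifs <;> simp
  have h2 : law μ (fun ω => (g (A ω), B ω)) (d, b)
      = ∑ a, if g a = d then law μ (fun ω => (A ω, B ω)) (a, b) else 0 := by
    rw [← law_law μ (fun ω => (A ω, B ω)) fun p => (g p.1, p.2), law_apply,
      Fintype.sum_prod_type]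
    refine Finset.sum_congr rfl fun a _ => ?_
    simp only [Prod.mk.injEq, ite_and]
    split_ifs <;> simp
  rw [h3, h2, Finset.sum_mul, Finset.sum_mul]
  refine Finset.sum_congr rfl fun a _ => ?_
  split_ifs
  · exact h a b c
  · simp

theorem MarkovChain.comp_right [Fintype 𝒜] [Fintype ℬ] [Fintype 𝒞] (h : MarkovChain μ A B C) (g : 𝒞 → 𝒟) :
    MarkovChain μ A B fun ω => g (C ω) :=
  (h.symm.comp_left g).symm

/-- A joint law factoring as `F (a, b) * G (b, c)` gives a Markov chain. -/
theorem MarkovChain.of_factorization [Fintype 𝒜] [Fintype 𝒞] (F : 𝒜 → ℬ → ℝ) (G : ℬ → 𝒞 → ℝ)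
    (h : ∀ a b c, law μ (fun ω => (A ω, B ω, C ω)) (a, b, c) = F a b * G b c) :
    MarkovChain μ A B C := by
  have hBC : ∀ b c, law μ (fun ω => (B ω, C ω)) (b, c) = (∑ a, F a b) * G b c := by
    intro b c
    rw [← sum_law_pair_left μ A, Finset.sum_mul]
    exact Finset.sum_congr rfl fun a _ => h a b c
  have hAB : ∀ a b, law μ (fun ω => (A ω, B ω)) (a, b) = F a b * ∑ c, G b c := by
    intro a b
    rw [← sum_law_pair_right μ (fun ω => (A ω, B ω)) C, Finset.mul_sum]
    refine Finset.sum_congr rfl fun c _ => ?_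
    rw [← h a b c]
    simp [law_apply, and_assoc]
  have hB : ∀ b, law μ B b = (∑ a, F a b) * ∑ c, G b c := by
    intro b
    rw [← sum_law_pair_left μ A, Finset.sum_mul]
    exact Finset.sum_congr rfl fun a _ => hAB a b
  rw [markovChain_iff_law]
  intro a b c
  rw [h, hAB, hBC, hB]
  ring

theorem MarkovChain.ent_eq [Fintype 𝒜] [Fintype ℬ] [Fintype 𝒞] (hμ : ∀ ω, 0 ≤ μ ω) (h : MarkovChain μ A B C) :
    ent μ (fun ω => (A ω, B ω, C ω)) + ent μ B
      = ent μ (fun ω => (A ω, B ω)) + ent μ (fun ω => (B ω, C ω)) := by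
  rw [markovChain_iff_law] at h
  set T : Ω → 𝒜 × ℬ × 𝒞 := fun ω => (A ω, B ω, C ω) with hT
  have key : ∀ {𝒮 : Type} [Fintype 𝒮] (g : 𝒜 × ℬ × 𝒞 → 𝒮),
      ent μ (fun ω => g (T ω))
        = -∑ t, law μ T t * Real.logb 2 (law μ (fun ω => g (T ω)) (g t)) := by
    intro 𝒮 _ g
    rw [ent]
    congr 1
    have : ∀ s, law μ (fun ω => g (T ω)) s * Real.logb 2 (law μ (fun ω => g (T ω)) s)
        = ∑ t, if g t = s then law μ T t * Real.logb 2 (law μ (fun ω => g (T ω)) (g t)) else 0 := by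
      intro s
      have hs : law μ (fun ω => g (T ω)) s = ∑ t, if g t = s then law μ T t else 0 := by
        rw [← law_law, law_apply]
      conv_lhs => rw [hs, Finset.sum_mul, ← hs]
      refine Finset.sum_congr rfl fun t _ => ?_
      split_ifs with hs
      · rw [hs]
      · simp
    simp only [this]
    rw [Finset.sum_comm]
    simp
  have hABC := key fun t => t
  have hB := key fun t => t.2.1
  have hAB := key fun t => (t.1, t.2.1)
  have hBC := key fun t => t.2
  simp only [hT] at hABC hB hAB hBC
  rw [hABC, hB, hAB, hBC, ← neg_add, ← neg_add, ← Finset.sum_add_distrib,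
    ← Finset.sum_add_distrib]
  congr 1
  refine Finset.sum_congr rfl fun t _ => ?_
  obtain ⟨a, b, c⟩ := t
  rw [← mul_add, ← mul_add]
  rcases eq_or_ne (law μ (fun ω => (A ω, B ω, C ω)) (a, b, c)) 0 with h0 | h0
  · simp [h0]
  have hne : ∀ {𝒮 : Type} [Fintype 𝒮] (g : 𝒜 × ℬ × 𝒞 → 𝒮),
      law μ (fun ω => g (T ω)) (g (a, b, c)) ≠ 0 := fun g h =>
    h0 (law_eq_zero_of_law_comp_eq_zero hμ T g h)
  have h1 := hne fun t => t.2.1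
  have h2 := hne fun t => (t.1, t.2.1)
  have h3 := hne fun t => t.2
  simp only [hT] at h1 h2 h3
  rw [← Real.logb_mul h0 h1, ← Real.logb_mul h2 h3, h a b c]

end Markov

section Information

variable {Ω 𝒱 𝒳 𝒴 𝒲 𝒵 𝒞 : Type} [Fintype Ω] [Fintype 𝒱] [Fintype 𝒳]

theorem condMutInf_eq_condEnt_sub [Fintype 𝒞] (μ : Ω → ℝ) (V : Ω → 𝒱) (X : Ω → 𝒳) (C : Ω → 𝒞) :
    condMutInf μ V X C = condEnt μ X C - condEnt μ X (fun ω => (V ω, C ω)) := by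
  have hperm : ent μ (fun ω => ((V ω, X ω), C ω)) = ent μ (fun ω => (X ω, (V ω, C ω))) :=
    ent_eq_of_comp (fun p => ((p.2.1, p.1), p.2.2)) (fun p => (p.1.2, (p.1.1, p.2)))
      (fun _ => rfl) (fun _ => rfl) fun _ => rfl
  simp only [condMutInf, condEnt, hperm]
  ring

variable [Fintype 𝒴] [Fintype 𝒲] [Fintype 𝒵] {μ : Ω → ℝ} {V : Ω → 𝒱} {X : Ω → 𝒳} {Y : Ω → 𝒴}
  {W : Ω → 𝒲} {Z : Ω → 𝒵}

theorem MarkovChain.condMutInf_eq (hμ : ∀ ω, 0 ≤ μ ω) (h : MarkovChain μ V Y W) :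
    condMutInf μ Y W V = condEnt μ W V - condEnt μ W Y := by
  have h1 := h.ent_eq hμ
  have h2 : ent μ (fun ω => (W ω, (Y ω, V ω))) = ent μ (fun ω => (V ω, Y ω, W ω)) :=
    ent_eq_of_comp (fun p => (p.2.2, (p.2.1, p.1))) (fun p => (p.2.2, p.2.1, p.1))
      (fun _ => rfl) (fun _ => rfl) fun _ => rfl
  have h3 : ent μ (fun ω => (Y ω, V ω)) = ent μ (fun ω => (V ω, Y ω)) :=
    ent_eq_of_comp Prod.swap Prod.swap (fun _ => rfl) (fun _ => rfl) fun _ => rfl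
  have h4 : ent μ (fun ω => (W ω, Y ω)) = ent μ (fun ω => (Y ω, W ω)) :=
    ent_eq_of_comp Prod.swap Prod.swap (fun _ => rfl) (fun _ => rfl) fun _ => rfl
  rw [condMutInf_eq_condEnt_sub]
  simp only [condEnt, h2, h3, h4]
  linarith

theorem MarkovChain.condMutInf_eq_ent_sub (hμ : ∀ ω, 0 ≤ μ ω)
    (h : MarkovChain μ V X fun ω => (W ω, Z ω)) :
    condMutInf μ V X Z = ent μ (fun ω => (X ω, W ω, Z ω)) - ent μ Z
      - (condEnt μ X (fun ω => (V ω, W ω, Z ω)) + condEnt μ W (fun ω => (V ω, Z ω))) := by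
  have hWZ := h.ent_eq hμ
  have hZ := (h.comp_right Prod.snd).ent_eq hμ
  have h1 : ent μ (fun ω => (X ω, (V ω, W ω, Z ω))) = ent μ (fun ω => (V ω, X ω, W ω, Z ω)) :=
    ent_eq_of_comp (fun p => (p.2.1, (p.1, p.2.2))) (fun p => (p.2.1, (p.1, p.2.2)))
      (fun _ => rfl) (fun _ => rfl) fun _ => rfl
  have h2 : ent μ (fun ω => (W ω, (V ω, Z ω))) = ent μ (fun ω => (V ω, W ω, Z ω)) :=
    ent_eq_of_comp (fun p => (p.2.1, (p.1, p.2.2))) (fun p => (p.2.1, (p.1, p.2.2)))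
      (fun _ => rfl) (fun _ => rfl) fun _ => rfl
  have h3 : ent μ (fun ω => ((V ω, X ω), Z ω)) = ent μ (fun ω => (V ω, X ω, Z ω)) :=
    ent_eq_of_comp (fun p => ((p.1, p.2.1), p.2.2)) (fun p => (p.1.1, p.1.2, p.2))
      (fun _ => rfl) (fun _ => rfl) fun _ => rfl
  simp only [condMutInf, condEnt, h1, h2, h3]
  linarith

end Information

section Channel

variable {Ω 𝒱 𝒳 𝒴 𝒲 𝒵 : Type} [Fintype Ω] [Fintype 𝒱] [Fintype 𝒳] [Fintype 𝒴] [Fintype 𝒲]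
  [Fintype 𝒵]

/-- The joint mass function of `(X, S)` when `X ~ p` and `S` is obtained from `X` through the
conditional law of `S` given `X` under `μ`. -/
def throughChannel {𝒮 : Type} (μ : Ω → ℝ) (X : Ω → 𝒳) (S : Ω → 𝒮) (p : 𝒳 → ℝ) : 𝒳 × 𝒮 → ℝ :=
  fun t => p t.1 * (law μ (fun ω => (X ω, S ω)) t / law μ X t.1)

variable {μ : Ω → ℝ} {X : Ω → 𝒳}

theorem throughChannel_law {𝒮 : Type} [Fintype 𝒮] (hμ : ∀ ω, 0 ≤ μ ω) (S : Ω → 𝒮) :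
    throughChannel μ X S (law μ X) = law μ fun ω => (X ω, S ω) := by
  funext t
  refine mul_div_cancel_of_imp' fun h => ?_
  exact law_eq_zero_of_law_comp_eq_zero hμ (fun ω => (X ω, S ω)) Prod.fst h

theorem continuous_condEnt_throughChannel {𝒮 ℬ 𝒞 : Type} [Fintype 𝒮] [Fintype ℬ] [Fintype 𝒞]
    (S : Ω → 𝒮) (f : 𝒳 × 𝒮 → ℬ) (g : 𝒳 × 𝒮 → 𝒞) :
    Continuous fun p => condEnt (throughChannel μ X S p) f g := by
  have h : Continuous (throughChannel μ X S) := by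
    unfold throughChannel
    fun_prop
  exact ((continuous_ent _).comp h).sub ((continuous_ent _).comp h)

/-- Under `V − X − S`, the joint law of `(V, X, S)` is the mixture over `V` of the outputs of the
channel from `X` to `S`. -/
theorem MarkovChain.law_eq_mixture {𝒮 : Type} [Fintype 𝒮] (hμ : ∀ ω, 0 ≤ μ ω) {V : Ω → 𝒱}
    {S : Ω → 𝒮} (h : MarkovChain μ V X S) {p : 𝒱 → 𝒳 → ℝ}
    (hp : ∀ v x, law μ V v * p v x = law μ (fun ω => (V ω, X ω)) (v, x)) :
    law μ (fun ω => (V ω, X ω, S ω))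
      = fun t => law μ V t.1 * throughChannel μ X S (p t.1) t.2 := by
  funext ⟨v, x, s⟩
  rw [throughChannel, ← mul_assoc, hp, ← mul_div_assoc]
  rcases eq_or_ne (law μ X x) 0 with h0 | h0
  · rw [h0, div_zero]
    exact law_eq_zero_of_law_comp_eq_zero hμ (fun ω => (V ω, X ω, S ω)) (fun t => t.2.1) h0
  · rw [eq_div_iff h0]
    exact markovChain_iff_law.1 h v x s

section Mixture

variable {𝒮 𝒜 : Type} [Fintype 𝒮] [Fintype 𝒜] {S : Ω → 𝒮} {c : 𝒜 → ℝ} {p : 𝒜 → 𝒳 → ℝ}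

theorem law_snd_mixture (hμ : ∀ ω, 0 ≤ μ ω) (hcp : ∀ x, ∑ a, c a * p a x = law μ X x) :
    law (fun t : 𝒜 × 𝒳 × 𝒮 => c t.1 * throughChannel μ X S (p t.1) t.2) (fun t => t.2)
      = law μ fun ω => (X ω, S ω) := by
  rw [← throughChannel_law hμ]
  funext t
  rw [law_snd]
  simp only [throughChannel, ← mul_assoc, ← Finset.sum_mul, hcp]

theorem markovChain_mixture :
    MarkovChain (fun t : 𝒜 × 𝒳 × 𝒮 => c t.1 * throughChannel μ X S (p t.1) t.2)
      (fun t => t.1) (fun t => t.2.1) (fun t => t.2.2) := by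
  refine MarkovChain.of_factorization (fun a x => c a * p a x)
    (fun x s => law μ (fun ω => (X ω, S ω)) (x, s) / law μ X x) fun a x s => ?_
  rw [law_injective _ (g := fun t : 𝒜 × 𝒳 × 𝒮 => (t.1, t.2.1, t.2.2)) Function.injective_id
    (a, x, s), throughChannel, mul_assoc]

end Mixture

theorem MarkovChain.mixture {𝒜 : Type} [Fintype 𝒜] {c : 𝒜 → ℝ} {p : 𝒜 → 𝒳 → ℝ}
    {Y : Ω → 𝒴} {W : Ω → 𝒲} {Z : Ω → 𝒵} (hμ : ∀ ω, 0 ≤ μ ω)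
    (h : MarkovChain μ (fun ω => (X ω, Z ω)) Y W) :
    MarkovChain (fun t : 𝒜 × 𝒳 × 𝒴 × 𝒲 × 𝒵 =>
        c t.1 * throughChannel μ X (fun ω => (Y ω, W ω, Z ω)) (p t.1) t.2)
      (fun t => (t.1, t.2.1, t.2.2.2.2)) (fun t => t.2.2.1) (fun t => t.2.2.2.1) := by
  refine MarkovChain.of_factorization
    (fun b y => c b.1 * p b.1 b.2.1 *
      (law μ (fun ω => ((X ω, Z ω), Y ω)) ((b.2.1, b.2.2), y) / law μ X b.2.1))
    (fun y w => law μ (fun ω => (Y ω, W ω)) (y, w) / law μ Y y) ?_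
  rintro ⟨a, x, z⟩ y w
  have hinj : Function.Injective
      fun t : 𝒜 × 𝒳 × 𝒴 × 𝒲 × 𝒵 => ((t.1, t.2.1, t.2.2.2.2), t.2.2.1, t.2.2.2.1) := by
    rintro ⟨a, x, y, w, z⟩ ⟨a', x', y', w', z'⟩
    simp +contextual
  have hinj' : Function.Injective
      fun t : 𝒳 × 𝒴 × 𝒲 × 𝒵 => ((t.1, t.2.2.2), t.2.1, t.2.2.1) := by
    rintro ⟨x, y, w, z⟩ ⟨x', y', w', z'⟩
    simp +contextual
  have hr : law μ (fun ω => (X ω, Y ω, W ω, Z ω)) (x, y, w, z)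
      = law μ (fun ω => ((X ω, Z ω), Y ω)) ((x, z), y)
        * (law μ (fun ω => (Y ω, W ω)) (y, w) / law μ Y y) := by
    rw [← mul_div_assoc]
    rcases eq_or_ne (law μ Y y) 0 with h0 | h0
    · rw [h0, div_zero]
      exact law_eq_zero_of_law_comp_eq_zero hμ (fun ω => (X ω, Y ω, W ω, Z ω))
        (fun t => t.2.1) h0
    · rw [eq_div_iff h0, ← markovChain_iff_law.1 h (x, z) y w,
        ← law_comp_injective μ (fun ω => (X ω, Y ω, W ω, Z ω)) hinj' (x, y, w, z)]
  rw [law_injective _ hinj (a, x, y, w, z)]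
  simp only [throughChannel, hr]
  ring

end Channel

/-- Any mixture of probability vectors can be replaced by a mixture of at most `|𝒳| + 1`
probability vectors having the same mean and the same averages of two continuous functionals. -/
theorem exists_mixture_card_succ {𝒱 𝒳 : Type} [Fintype 𝒱] [Fintype 𝒳] [Nonempty 𝒳]
    {φ ψ : (𝒳 → ℝ) → ℝ} (hφ : Continuous φ) (hψ : Continuous ψ) {c : 𝒱 → ℝ} (hc : ∀ v, 0 ≤ c v)
    (hc1 : ∑ v, c v = 1) {p : 𝒱 → 𝒳 → ℝ} (hp : ∀ v, p v ∈ stdSimplex ℝ 𝒳) :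
    ∃ (c' : Fin (Fintype.card 𝒳 + 1) → ℝ) (p' : Fin (Fintype.card 𝒳 + 1) → 𝒳 → ℝ),
      (∀ i, 0 ≤ c' i) ∧ (∀ i, p' i ∈ stdSimplex ℝ 𝒳) ∧
      (∀ x, ∑ i, c' i * p' i x = ∑ v, c v * p v x) ∧
      ∑ i, c' i * φ (p' i) = ∑ v, c v * φ (p v) ∧
      ∑ i, c' i * ψ (p' i) = ∑ v, c v * ψ (p v) := by
  let Φ : (𝒳 → ℝ) → (𝒳 → ℝ) × ℝ × ℝ := fun p => (p, φ p, ψ p)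
  have hΦ : Continuous Φ := by fun_prop
  let ℓ : ((𝒳 → ℝ) × ℝ × ℝ) →ₗ[ℝ] ℝ :=
    (∑ x, LinearMap.proj x) ∘ₗ LinearMap.fst ℝ (𝒳 → ℝ) (ℝ × ℝ)
  have hconn : IsPreconnected (Φ '' stdSimplex ℝ 𝒳) :=
    (convex_stdSimplex ℝ 𝒳).isPreconnected.image Φ hΦ.continuousOn
  have hmem : ∑ v, c v • Φ (p v) ∈ convexHull ℝ (Φ '' stdSimplex ℝ 𝒳) :=
    (convex_convexHull ℝ _).sum_mem (fun v _ => hc v) hc1 fun v _ =>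
      subset_convexHull ℝ _ ⟨p v, hp v, rfl⟩
  obtain ⟨z, c', hz, hc', -, hsum⟩ := hconn.exists_fin_of_mem_convexHull ℓ
    (n := Fintype.card 𝒳 + 1)
    (by
      rintro _ ⟨p, hp, rfl⟩
      simpa [ℓ, Φ] using hp.2)
    (by omega) (by simp) hmem
  choose p' hp' hz' using hz
  simp only [← hz'] at hsum
  refine ⟨c', p', hc', hp', fun x => ?_, ?_, ?_⟩
  · simpa [Φ, Prod.fst_sum] using congrFun (congrArg Prod.fst hsum) x
  · simpa [Φ, Prod.fst_sum, Prod.snd_sum] using congrArg (fun t => t.2.1) hsum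
  · simpa [Φ, Prod.fst_sum, Prod.snd_sum] using congrArg (fun t => t.2.2) hsum

/-- cardinality reduction: under the Markov chains `V − X − (Y,W,Z)` and
`(V,X,Z) − Y − W`, there is a random variable `V′` over at most `|𝒳| + 1` values
(realized on the canonical sample space `Fin (|𝒳|+1) × 𝒳 × 𝒴 × 𝒲 × 𝒵`) with
`V′ − X − (Y,W,Z)`, the same joint law of `(X,Y,W,Z)`, and the same conditional
entropies and conditional mutual informations as stated. -/
theorem cardinality_bound
    (Ω 𝒳 𝒴 𝒵 𝒱 𝒲 F : Type)
    [Fintype Ω] [Fintype 𝒳] [Fintype 𝒴] [Fintype 𝒵] [Fintype 𝒱] [Fintype 𝒲] [Fintype F]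
    (μ : Ω → ℝ) (hμ0 : ∀ ω, 0 ≤ μ ω) (hμ1 : ∑ ω, μ ω = 1)
    (f : 𝒳 → 𝒴 → 𝒵 → F)
    (X : Ω → 𝒳) (Y : Ω → 𝒴) (Z : Ω → 𝒵) (V : Ω → 𝒱) (W : Ω → 𝒲)
    (hMk1 : MarkovChain μ V X (fun ω => (Y ω, W ω, Z ω)))
    (hMk2 : MarkovChain μ (fun ω => (V ω, X ω, Z ω)) Y W) :
    ∃ q : (Fin (Fintype.card 𝒳 + 1) × 𝒳 × 𝒴 × 𝒲 × 𝒵) → ℝ,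
      (∀ a, 0 ≤ q a) ∧ (∑ a, q a = 1) ∧
      -- V′ − X − (Y,W,Z)
      MarkovChain q (fun a => a.1) (fun a => a.2.1)
        (fun a => (a.2.2.1, a.2.2.2.1, a.2.2.2.2)) ∧
      -- the joint distribution of (X,Y,W,Z) is unchanged
      law q (fun a => a.2) = law μ (fun ω => (X ω, Y ω, W ω, Z ω)) ∧
      -- H(X|V′,W,Z) = H(X|V,W,Z)
      condEnt q (fun a => a.2.1) (fun a => (a.1, a.2.2.2.1, a.2.2.2.2))
        = condEnt μ X (fun ω => (V ω, W ω, Z ω)) ∧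
      -- H(W|V′,Z) = H(W|V,Z)
      condEnt q (fun a => a.2.2.2.1) (fun a => (a.1, a.2.2.2.2))
        = condEnt μ W (fun ω => (V ω, Z ω)) ∧
      -- I(V′;X|W,Z) = I(V;X|W,Z)
      condMutInf q (fun a => a.1) (fun a => a.2.1) (fun a => (a.2.2.2.1, a.2.2.2.2))
        = condMutInf μ V X (fun ω => (W ω, Z ω)) ∧
      -- I(Y;W|V′,Z) = I(Y;W|V,Z)
      condMutInf q (fun a => a.2.2.1) (fun a => a.2.2.2.1) (fun a => (a.1, a.2.2.2.2))
        = condMutInf μ Y W (fun ω => (V ω, Z ω)) ∧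
      -- I(V′;X|Z) + I(Y;W|V′,Z) = I(V;X|Z) + I(Y;W|V,Z)
      condMutInf q (fun a => a.1) (fun a => a.2.1) (fun a => a.2.2.2.2)
        + condMutInf q (fun a => a.2.2.1) (fun a => a.2.2.2.1) (fun a => (a.1, a.2.2.2.2))
        = condMutInf μ V X Z + condMutInf μ Y W (fun ω => (V ω, Z ω)) := by
  have hX : Nonempty 𝒳 := by
    by_contra hX
    have : IsEmpty Ω := ⟨fun ω => hX ⟨X ω⟩⟩
    simp at hμ1
  set S : Ω → 𝒴 × 𝒲 × 𝒵 := fun ω => (Y ω, W ω, Z ω)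
  set p : 𝒱 → 𝒳 → ℝ := fun v =>
    if law μ V v = 0 then law μ X else fun x => law μ (fun ω => (V ω, X ω)) (v, x) / law μ V v
    with hp
  have hpmul : ∀ v x, law μ V v * p v x = law μ (fun ω => (V ω, X ω)) (v, x) := by
    intro v x
    by_cases h0 : law μ V v = 0
    · rw [h0, zero_mul]
      exact (law_eq_zero_of_law_comp_eq_zero hμ0 (fun ω => (V ω, X ω)) Prod.fst h0).symm
    · simp only [hp, if_neg h0]
      exact mul_div_cancel₀ _ h0
  have hpmem : ∀ v, p v ∈ stdSimplex ℝ 𝒳 := by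
    intro v
    by_cases h0 : law μ V v = 0
    · simp only [hp, if_pos h0]
      exact ⟨law_nonneg hμ0 X, by rw [sum_law, hμ1]⟩
    · simp only [hp, if_neg h0]
      refine ⟨fun x => div_nonneg (law_nonneg hμ0 _ _) (law_nonneg hμ0 _ _), ?_⟩
      rw [← Finset.sum_div, sum_law_pair_right, div_self h0]
  obtain ⟨c, p', hc, hp', hmean, hH₁, hH₂⟩ := exists_mixture_card_succ
    (continuous_condEnt_throughChannel (μ := μ) (X := X) S (fun s => s.1)
      fun s => (s.2.2.1, s.2.2.2))
    (continuous_condEnt_throughChannel (μ := μ) (X := X) S (fun s => s.2.2.1) fun s => s.2.2.2)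
    (law_nonneg hμ0 V) (by rw [sum_law, hμ1]) hpmem
  simp only [hpmul, sum_law_pair_left] at hmean
  simp only [← condEnt_mixture, ← hMk1.law_eq_mixture hμ0 hpmul] at hH₁ hH₂
  set q : Fin (Fintype.card 𝒳 + 1) × 𝒳 × 𝒴 × 𝒲 × 𝒵 → ℝ :=
    fun t => c t.1 * throughChannel μ X S (p' t.1) t.2
  have hq0 : ∀ a, 0 ≤ q a := fun a => mul_nonneg (hc _) <| mul_nonneg ((hp' _).1 _) <|
    div_nonneg (law_nonneg hμ0 _ _) (law_nonneg hμ0 _ _)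
  have hlaw : law q (fun a => a.2) = law μ (fun ω => (X ω, Y ω, W ω, Z ω)) :=
    law_snd_mixture hμ0 hmean
  have hent : ∀ {𝒞 : Type} [Fintype 𝒞] (g : 𝒳 × 𝒴 × 𝒲 × 𝒵 → 𝒞),
      ent q (fun a => g a.2) = ent μ fun ω => g (X ω, Y ω, W ω, Z ω) := by
    intro 𝒞 _ g
    rw [← ent_law q, hlaw, ent_law]
  have hcond : ∀ {ℬ 𝒞 : Type} [Fintype ℬ] [Fintype 𝒞] (f : 𝒳 × 𝒴 × 𝒲 × 𝒵 → ℬ)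
      (g : 𝒳 × 𝒴 × 𝒲 × 𝒵 → 𝒞), condEnt q (fun a => f a.2) (fun a => g a.2)
        = condEnt μ (fun ω => f (X ω, Y ω, W ω, Z ω)) fun ω => g (X ω, Y ω, W ω, Z ω) := by
    intro ℬ 𝒞 _ _ f g
    rw [← condEnt_law q, hlaw, condEnt_law]
  have hq1 : MarkovChain q (fun a => a.1) (fun a => a.2.1) (fun a => a.2.2) := markovChain_mixture
  have hq2 : MarkovChain q (fun a => (a.1, a.2.1, a.2.2.2.2)) (fun a => a.2.2.1)
      (fun a => a.2.2.2.1) := (hMk2.comp_left Prod.snd).mixture hμ0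
  have hH₁' : condEnt q (fun a => a.2.1) (fun a => (a.1, a.2.2.2.1, a.2.2.2.2))
      = condEnt μ X (fun ω => (V ω, W ω, Z ω)) :=
    hH₁.trans (condEnt_law μ _ _ _)
  have hH₂' : condEnt q (fun a => a.2.2.2.1) (fun a => (a.1, a.2.2.2.2))
      = condEnt μ W (fun ω => (V ω, Z ω)) :=
    hH₂.trans (condEnt_law μ _ _ _)
  have hYW : condMutInf q (fun a => a.2.2.1) (fun a => a.2.2.2.1) (fun a => (a.1, a.2.2.2.2))
      = condMutInf μ Y W (fun ω => (V ω, Z ω)) := by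
    rw [(hq2.comp_left fun t => (t.1, t.2.2)).condMutInf_eq hq0,
      (hMk2.comp_left fun t => (t.1, t.2.2)).condMutInf_eq hμ0, hH₂',
      hcond (fun s => s.2.2.1) fun s => s.2.1]
  refine ⟨q, hq0, ?_, hq1, hlaw, hH₁', hH₂', ?_, hYW, ?_⟩
  · rw [← sum_law q fun a => a.2, hlaw, sum_law, hμ1]
  · rw [condMutInf_eq_condEnt_sub, condMutInf_eq_condEnt_sub, hH₁',
      hcond (fun s => s.1) fun s => s.2.2]
  · rw [hYW, (hq1.comp_right fun t => (t.2.1, t.2.2)).condMutInf_eq_ent_sub hq0,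
      (hMk1.comp_right fun t => (t.2.1, t.2.2)).condMutInf_eq_ent_sub hμ0, hH₁', hH₂',
      hent fun s => s.2.2.2, hent fun s => (s.1, s.2.2.1, s.2.2.2)]
end
end

section
/- Let V, X, Y, W be random variables such that the Markov chains V − X − (Y,W) and (V,X) − Y − W hold. Then V − X − Y − W is a Markov chain (i.e., the joint distribution factors as p(v,x,y,w) = p(x,y)·p(v|x)·p(w|y)), and I(V;X) + I(Y;W|V) = I(X,Y;V,W). -/
open Finset

attribute [local instance] Classical.propDecidable

noncomputable section

lemma pr_eq_sum_pr_and {Ω ℬ : Type} [Fintype Ω] [Fintype ℬ] (μ : Ω → ℝ) (P : Ω → Prop)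
    (B : Ω → ℬ) : pr μ {ω | P ω} = ∑ b, pr μ {ω | P ω ∧ B ω = b} := by
  unfold pr
  rw [Finset.sum_comm]
  refine Finset.sum_congr rfl fun ω _ => ?_
  by_cases h : P ω <;> simp [h]

lemma le_law_apply {Ω 𝒜 : Type} [Fintype Ω] {μ : Ω → ℝ} (hμ : ∀ ω, 0 ≤ μ ω) (X : Ω → 𝒜)
    (ω : Ω) : μ ω ≤ law μ X (X ω) := by
  unfold law pr
  have h := Finset.single_le_sum (f := fun ω' => if ω' ∈ {ω' | X ω' = X ω} then μ ω' else 0)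
    (fun ω' _ => by split_ifs <;> simp [hμ]) (Finset.mem_univ ω)
  simpa using h

lemma ent_eq_neg_sum {Ω 𝒜 : Type} [Fintype Ω] [Fintype 𝒜] (μ : Ω → ℝ) (X : Ω → 𝒜) :
    ent μ X = -∑ ω, μ ω * Real.logb 2 (law μ X (X ω)) := by
  have h (a : 𝒜) : law μ X a * Real.logb 2 (law μ X a)
      = ∑ ω, if X ω = a then μ ω * Real.logb 2 (law μ X (X ω)) else 0 := by
    conv_lhs => enter [1]; unfold law pr
    rw [Finset.sum_mul]
    refine Finset.sum_congr rfl fun ω _ => ?_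
    by_cases hω : X ω = a <;> simp [hω]
  unfold ent
  simp_rw [h]
  rw [Finset.sum_comm]
  simp

lemma ent_congr {Ω 𝒜 ℬ : Type} [Fintype Ω] [Fintype 𝒜] [Fintype ℬ] (μ : Ω → ℝ)
    {X : Ω → 𝒜} {Z : Ω → ℬ} (h : ∀ ω ω', X ω = X ω' ↔ Z ω = Z ω') : ent μ X = ent μ Z := by
  simp only [ent_eq_neg_sum, law, h]

namespace MarkovChain

variable {Ω 𝒜 ℬ 𝒞 𝒟 : Type} [Fintype Ω] {μ : Ω → ℝ} {U : Ω → 𝒜} {V : Ω → ℬ} {W : Ω → 𝒞}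
  {T : Ω → 𝒟}

lemma symm_s3 (h : MarkovChain μ U V W) : MarkovChain μ W V U := by
  intro c b a
  have := h a b c
  rw [show {ω | W ω = c ∧ V ω = b ∧ U ω = a} = {ω | U ω = a ∧ V ω = b ∧ W ω = c} by ext; grind,
    show {ω | W ω = c ∧ V ω = b} = {ω | V ω = b ∧ W ω = c} by ext; grind,
    show {ω | V ω = b ∧ U ω = a} = {ω | U ω = a ∧ V ω = b} by ext; grind, this, mul_comm]

lemma fst_right [Fintype 𝒟] (h : MarkovChain μ U V (fun ω => (W ω, T ω))) :
    MarkovChain μ U V W := by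
  intro a b c
  rw [pr_eq_sum_pr_and μ (fun ω => U ω = a ∧ V ω = b ∧ W ω = c) T,
    pr_eq_sum_pr_and μ (fun ω => V ω = b ∧ W ω = c) T, Finset.sum_mul, Finset.mul_sum]
  refine Finset.sum_congr rfl fun d _ => ?_
  simpa only [Prod.mk.injEq, and_assoc] using h a b (c, d)

lemma ent_add_ent [Fintype 𝒜] [Fintype ℬ] [Fintype 𝒞] (hμ : ∀ ω, 0 ≤ μ ω)
    (h : MarkovChain μ U V W) :
    ent μ (fun ω => (U ω, V ω, W ω)) + ent μ V
      = ent μ (fun ω => (U ω, V ω)) + ent μ (fun ω => (V ω, W ω)) := by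
  simp only [ent_eq_neg_sum, ← neg_add, ← Finset.sum_add_distrib]
  congr 1
  refine Finset.sum_congr rfl fun ω _ => ?_
  rcases (hμ ω).eq_or_lt with h0 | h0
  · simp [← h0]
  have hne {α : Type} (Z : Ω → α) : law μ Z (Z ω) ≠ 0 := (h0.trans_le (le_law_apply hμ Z ω)).ne'
  rw [← mul_add, ← mul_add,
    ← Real.logb_mul (hne fun ω => (U ω, V ω, W ω)) (hne V),
    ← Real.logb_mul (hne fun ω => (U ω, V ω)) (hne fun ω => (V ω, W ω))]
  have := h (U ω) (V ω) (W ω)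
  simp only [law, Prod.mk.injEq]
  rw [this]

end MarkovChain

/-- if `V − X − (Y,W)` and `(V,X) − Y − W` are Markov chains, then
`V − X − Y − W` is a (long) Markov chain, i.e. `p(v,x,y,w)·p(x)·p(y) = p(x,y)·p(v,x)·p(w,y)`,
and `I(V;X) + I(Y;W|V) = I(X,Y;V,W)`. -/
theorem long_markov_chain_and_sum_rate
    (Ω 𝒳 𝒴 𝒱 𝒲 : Type)
    [Fintype Ω] [Fintype 𝒳] [Fintype 𝒴] [Fintype 𝒱] [Fintype 𝒲]
    (μ : Ω → ℝ) (hμ0 : ∀ ω, 0 ≤ μ ω) (hμ1 : ∑ ω, μ ω = 1)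
    (X : Ω → 𝒳) (Y : Ω → 𝒴) (V : Ω → 𝒱) (W : Ω → 𝒲)
    (hMk1 : MarkovChain μ V X (fun ω => (Y ω, W ω)))
    (hMk2 : MarkovChain μ (fun ω => (V ω, X ω)) Y W) :
    (∀ v x y w,
      pr μ {ω | V ω = v ∧ X ω = x ∧ Y ω = y ∧ W ω = w} * pr μ {ω | X ω = x}
          * pr μ {ω | Y ω = y}
        = pr μ {ω | X ω = x ∧ Y ω = y} * pr μ {ω | V ω = v ∧ X ω = x}
          * pr μ {ω | W ω = w ∧ Y ω = y}) ∧
    mutInf μ V X + condMutInf μ Y W V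
      = mutInf μ (fun ω => (X ω, Y ω)) (fun ω => (V ω, W ω)) := by
  have hVXY : MarkovChain μ V X Y := hMk1.fst_right
  have hVYW : MarkovChain μ W Y V := hMk2.symm_s3.fst_right
  constructor
  · intro v x y w
    have h₁ := hVXY v x y
    have h₂ := hMk2 (v, x) y w
    simp only [Prod.mk.injEq, and_assoc] at h₂
    rw [show {ω | W ω = w ∧ Y ω = y} = {ω | Y ω = y ∧ W ω = w} by ext; grind]
    linear_combination pr μ {ω | X ω = x} * h₂ + pr μ {ω | Y ω = y ∧ W ω = w} * h₁
  · have h₁ := hVXY.ent_add_ent hμ0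
    have h₂ := hVYW.ent_add_ent hμ0
    have h₃ := hMk2.ent_add_ent hμ0
    have e₁ : ent μ (fun ω => ((V ω, X ω), Y ω, W ω))
        = ent μ (fun ω => ((X ω, Y ω), V ω, W ω)) := ent_congr μ (by grind)
    have e₂ : ent μ (fun ω => ((V ω, X ω), Y ω)) = ent μ (fun ω => (V ω, X ω, Y ω)) :=
      ent_congr μ (by grind)
    have e₃ : ent μ (fun ω => (W ω, Y ω, V ω)) = ent μ (fun ω => ((Y ω, W ω), V ω)) :=
      ent_congr μ (by grind)
    have e₄ : ent μ (fun ω => (W ω, Y ω)) = ent μ (fun ω => (Y ω, W ω)) :=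
      ent_congr μ (by grind)
    have e₅ : ent μ (fun ω => (W ω, V ω)) = ent μ (fun ω => (V ω, W ω)) :=
      ent_congr μ (by grind)
    unfold mutInf condMutInf condEnt
    linarith
end
end
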